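/- Let f, g be nonnegative functions on Z/pZ (p an odd prime) and let h_1, ..., h_n be △-regular nonnegative functions. Then the convolution evaluated at 0 satisfies f ⋆ g ⋆ h_1 ⋆ ... ⋆ h_n (0) ≤ f^+ ⋆ g^- ⋆ h_1^* ⋆ ... ⋆ h_n^* (0). -/

import Mathlib

open scoped BigOperators ENNReal Classical

namespace Paper

variable {p : ℕ}

/-- Convolution of two functions on `ZMod p`. -/
noncomputable def conv [NeZero p] (f g : ZMod p → ℝ) : ZMod p → ℝ :=
  fun k => ∑ i : ZMod p, f i * g (k - i)

/-- Iterated convolution of a list of functions (the delta mass at `0` is the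
convolution identity used as the base of the fold). -/
noncomputable def convList [NeZero p] (l : List (ZMod p → ℝ)) : ZMod p → ℝ :=
  l.foldr conv (fun k => if k = 0 then 1 else 0)

/-- The enumeration `0, +1, -1, +2, -2, ...` of `ZMod p`. -/
def plusSeq (p : ℕ) (n : ℕ) : ZMod p :=
  if n % 2 = 0 then -((n / 2 : ℕ) : ZMod p) else (((n + 1) / 2 : ℕ) : ZMod p)

/-- The enumeration `0, -1, +1, -2, +2, ...` of `ZMod p`. -/
def minusSeq (p : ℕ) (n : ℕ) : ZMod p := -(plusSeq p n)

/-- `fp` is the `+`-rearrangement of `f`: a permutation of the values of `f` that is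
nonincreasing along the ordering `0, +1, -1, +2, -2, ...`. -/
def IsPlusRearr (f fp : ZMod p → ℝ) : Prop :=
  (∃ σ : Equiv.Perm (ZMod p), fp = f ∘ σ) ∧
    ∀ n : ℕ, n + 1 < p → fp (plusSeq p (n + 1)) ≤ fp (plusSeq p n)

/-- `fm` is the `-`-rearrangement of `f`: a permutation of the values of `f` that is
nonincreasing along the ordering `0, -1, +1, -2, +2, ...`. -/
def IsMinusRearr (f fm : ZMod p → ℝ) : Prop :=
  (∃ σ : Equiv.Perm (ZMod p), fm = f ∘ σ) ∧
    ∀ n : ℕ, n + 1 < p → fm (minusSeq p (n + 1)) ≤ fm (minusSeq p n)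

/-- `f` is `△`-regular: its `+`-rearrangement is symmetric (so `f⁺ = f⁻`). -/
def TriangleRegular (f : ZMod p → ℝ) : Prop :=
  ∃ fp, IsPlusRearr f fp ∧ ∀ z, fp (-z) = fp z

/-- `f` is `□`-regular: `f⁺(z+1) = f⁻(z)` for all `z`. -/
def SquareRegular (f : ZMod p → ℝ) : Prop :=
  ∃ fp fm, IsPlusRearr f fp ∧ IsMinusRearr f fm ∧ ∀ z, fp (z + 1) = fm z

/-- probability mass function on `ZMod p`. -/
def IsPMF [NeZero p] (f : ZMod p → ℝ) : Prop :=
  (∀ i, 0 ≤ f i) ∧ ∑ i : ZMod p, f i = 1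

/-- Weak majorization: for every `r`, the sum of the `r` largest values of `f` is at most
the sum of the `r` largest values of `g` (expressed via subsets of each cardinality). -/
def WeakMaj [NeZero p] (f g : ZMod p → ℝ) : Prop :=
  ∀ s : Finset (ZMod p), ∃ t : Finset (ZMod p),
    t.card = s.card ∧ ∑ i ∈ s, f i ≤ ∑ i ∈ t, g i

/-- Majorization: weak majorization together with equality of total sums. -/
def Maj [NeZero p] (f g : ZMod p → ℝ) : Prop :=
  WeakMaj f g ∧ ∑ i : ZMod p, f i = ∑ i : ZMod p, g i

/-- `f` and `g` are shape-equivalent: there is a single ordering of the index set along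
which both are nonincreasing. -/
def ShapeEquiv [NeZero p] (f g : ZMod p → ℝ) : Prop :=
  ∃ e : Fin p ≃ ZMod p, (∀ m n : Fin p, m ≤ n → f (e n) ≤ f (e m)) ∧
    (∀ m n : Fin p, m ≤ n → g (e n) ≤ g (e m))

/-- Rényi entropy of order `α ∈ [0,∞]` of a pmf on `ZMod p`. -/
noncomputable def renyi [NeZero p] (α : ℝ≥0∞) (f : ZMod p → ℝ) : ℝ :=
  if α = 0 then Real.log ((Finset.univ.filter (fun i => f i ≠ 0)).card)
  else if α = 1 then ∑ i : ZMod p, Real.negMulLog (f i)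
  else if α = ⊤ then -Real.log (⨆ i : ZMod p, f i)
  else (1 - α.toReal)⁻¹ * Real.log (∑ i : ZMod p, f i ^ α.toReal)

open Finset

section Pollard

variable {G : Type*} [AddCommGroup G] [DecidableEq G]

/-- The number of representations `z = x + y` with `x ∈ A` and `y ∈ C`. -/
def sumRep (A C : Finset G) (z : G) : ℕ := #{x ∈ A | z - x ∈ C}

lemma sumRep_comm (A C : Finset G) (z : G) : sumRep A C z = sumRep C A z := by
  refine card_bij' (fun x _ => z - x) (fun x _ => z - x) ?_ ?_ ?_ ?_ <;>
    simp +contextual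

lemma sumRep_le_left (A C : Finset G) (z : G) : sumRep A C z ≤ #A := card_filter_le _ _

lemma sumRep_le_right (A C : Finset G) (z : G) : sumRep A C z ≤ #C :=
  sumRep_comm A C z ▸ sumRep_le_left C A z

lemma sumRep_union_left {A B : Finset G} (h : Disjoint A B) (C : Finset G) (z : G) :
    sumRep (A ∪ B) C z = sumRep A C z + sumRep B C z := by
  unfold sumRep
  rw [filter_union, card_union_of_disjoint (disjoint_filter_filter h)]

lemma sumRep_union_right {B C : Finset G} (h : Disjoint B C) (A : Finset G) (z : G) :
    sumRep A (B ∪ C) z = sumRep A B z + sumRep A C z := by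
  simp only [sumRep_comm A, sumRep_union_left h]

lemma sum_sumRep [Fintype G] (A C : Finset G) : ∑ z, sumRep A C z = #A * #C := by
  simp only [sumRep, card_filter]
  rw [sum_comm, card_eq_sum_ones A, sum_mul]
  refine sum_congr rfl fun x _ => ?_
  refine ((Equiv.subRight x).sum_comp (fun z => if z ∈ C then 1 else 0)).trans ?_
  simp

lemma sumRep_image_add (A C : Finset G) (e z : G) :
    sumRep A (C.image (· + e)) z = sumRep A C (z - e) := by
  unfold sumRep
  congr 1
  refine filter_congr fun x _ => ?_
  simp only [mem_image]
  constructor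
  · rintro ⟨c, hc, h⟩
    rwa [show z - e - x = c by rw [sub_right_comm, ← h, add_sub_cancel_right]]
  · intro h
    exact ⟨_, h, by abel⟩

lemma sumRep_eq_inter_add_sdiff (A C : Finset G) (z : G) :
    sumRep A C z = sumRep (A ∪ C) (A ∩ C) z + sumRep (A \ C) (C \ A) z := by
  have hA : A = A \ C ∪ A ∩ C := (sdiff_union_inter A C).symm
  have hC : C = C \ A ∪ A ∩ C := by rw [inter_comm]; exact (sdiff_union_inter C A).symm
  have h1 : A ∪ C = A ∪ C \ A := (union_sdiff_self_eq_union).symm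
  have hd : Disjoint (C \ A) (A ∩ C) := by rw [inter_comm]; exact disjoint_sdiff_inter C A
  calc sumRep A C z = sumRep A (C \ A ∪ A ∩ C) z := by rw [← hC]
    _ = sumRep A (C \ A) z + sumRep A (A ∩ C) z := sumRep_union_right hd A z
    _ = sumRep (A \ C ∪ A ∩ C) (C \ A) z + sumRep A (A ∩ C) z := by rw [← hA]
    _ = sumRep (A \ C) (C \ A) z + sumRep (C \ A) (A ∩ C) z + sumRep A (A ∩ C) z := by
        rw [sumRep_union_left (disjoint_sdiff_inter A C), sumRep_comm (A ∩ C)]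
    _ = _ := by
        rw [h1, sumRep_union_left disjoint_sdiff]
        ring

end Pollard

section Pollard

variable {p : ℕ} [Fact p.Prime]

lemma exists_translate_inter_ssubset {A C : Finset (ZMod p)} (hA : A.Nonempty) (hA' : #A < p)
    (hC : 1 < #C) :
    ∃ e, (A ∩ C.image (· + e)).Nonempty ∧ ¬ C.image (· + e) ⊆ A := by
  by_contra! hcon
  obtain ⟨c, hc, d, hd, hcd⟩ := one_lt_card.1 hC
  have hstep : ∀ x ∈ A, x + (d - c) ∈ A := by
    intro x hx
    refine hcon (x - c) ⟨x, mem_inter.2 ⟨hx, mem_image.2 ⟨c, hc, by ring⟩⟩⟩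
      (mem_image.2 ⟨d, hd, by ring⟩)
  obtain ⟨x, hx⟩ := hA
  have hmul : ∀ n : ℕ, x + n * (d - c) ∈ A := by
    intro n
    induction n with
    | zero => simpa using hx
    | succ n ih =>
      have := hstep _ ih
      rwa [show x + ((n + 1 : ℕ) : ZMod p) * (d - c) = x + n * (d - c) + (d - c) by
        push_cast; ring]
  have hne : d - c ≠ 0 := sub_ne_zero.2 hcd.symm
  have huniv : A = univ := by
    refine eq_univ_iff_forall.2 fun z => ?_
    have := hmul ((z - x) / (d - c)).val
    rwa [ZMod.natCast_zmod_val, div_mul_cancel₀ _ hne, add_sub_cancel] at this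
  rw [huniv, card_univ, ZMod.card] at hA'
  exact lt_irrefl _ hA'

/-- Pollard's theorem, in the range where the sumset does not have to be everything. -/
theorem pollard (A C : Finset (ZMod p)) (t : ℕ) (htA : t ≤ #A) (htC : t ≤ #C)
    (hp : #A + #C ≤ p + t) :
    t * (#A + #C) ≤ ∑ z, min t (sumRep A C z) + t * t := by
  induction hn : #C using Nat.strong_induction_on generalizing A C t with
  | _ n ih =>
    subst hn
    rcases Nat.eq_zero_or_pos t with rfl | ht
    · simp
    rcases htC.eq_or_lt with rfl | htC'
    · have : ∀ z, min #C (sumRep A C z) = sumRep A C z := fun z =>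
        min_eq_right (sumRep_le_right A C z)
      simp only [this, sum_sumRep]
      exact le_of_eq (by ring)
    obtain ⟨e, hne, hsub⟩ := exists_translate_inter_ssubset (A := A) (C := C)
      (card_pos.1 (by omega)) (by omega) (by omega)
    set C' := C.image (· + e) with hC'
    have hcard : #C' = #C := card_image_of_injective _ (add_left_injective e)
    have hsum : ∑ z, min t (sumRep A C z) = ∑ z, min t (sumRep A C' z) := by
      simp only [hC', sumRep_image_add]
      exact ((Equiv.subRight e).sum_comp (fun z => min t (sumRep A C z))).symm
    rw [hsum, ← hcard]
    have hq : 0 < #(A ∩ C') := card_pos.2 hne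
    have hq' : #(A ∩ C') < #C' := by
      refine card_lt_card ⟨inter_subset_right, fun h => hsub (h.trans inter_subset_left)⟩
    have hui := card_union_add_card_inter A C'
    have hsA := card_sdiff_add_card_inter A C'
    have hsC := card_sdiff_add_card_inter C' A
    rw [inter_comm C' A] at hsC
    rcases le_or_gt t #(A ∩ C') with hcase | hcase
    · have := ih #(A ∩ C') (by omega) (A ∪ C') (A ∩ C') t (by omega) hcase (by omega) rfl
      rw [hui] at this
      refine this.trans (Nat.add_le_add_right (sum_le_sum fun z _ => ?_) _)
      have := sumRep_eq_inter_add_sdiff A C' z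
      omega
    · set q := #(A ∩ C') with hqdef
      have h2 := ih #(C' \ A) (by omega) (A \ C') (C' \ A) (t - q) (by omega) (by omega)
        (by omega) rfl
      have h1 := sum_sumRep (A ∪ C') (A ∩ C')
      have hle : ∑ z, sumRep (A ∪ C') (A ∩ C') z
          + ∑ z, min (t - q) (sumRep (A \ C') (C' \ A) z) ≤ ∑ z, min t (sumRep A C' z) := by
        rw [← sum_add_distrib]
        refine sum_le_sum fun z _ => ?_
        have := sumRep_eq_inter_add_sdiff A C' z
        have := sumRep_le_right (A ∪ C') (A ∩ C') z
        omega
      rw [h1, ← hqdef] at hle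
      obtain ⟨s, rfl⟩ : ∃ s, t = q + s := ⟨t - q, by omega⟩
      rw [Nat.add_sub_cancel_left] at h2 hle
      rw [← hsA, ← hsC]
      have hU : #(A ∪ C') = #(A \ C') + #(C' \ A) + q := by omega
      rw [hU] at hle
      nlinarith

end Pollard

section DiffRep

variable {G : Type*} [AddCommGroup G] [DecidableEq G]

/-- The number of representations `k = y - x` with `x ∈ A` and `y ∈ B`. -/
def diffRep (A B : Finset G) (k : G) : ℕ := #{x ∈ A | x + k ∈ B}

lemma diffRep_eq_sumRep_neg (A B : Finset G) (k : G) :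
    diffRep A B k = sumRep (A.image (-·)) B k := by
  unfold diffRep sumRep
  rw [filter_image, card_image_of_injective _ neg_injective]
  simp only [sub_neg_eq_add, add_comm k]

lemma diffRep_mono {A A' B B' : Finset G} (hA : A ⊆ A') (hB : B ⊆ B') (k : G) :
    diffRep A B k ≤ diffRep A' B' k :=
  card_le_card fun _ hx =>
    mem_filter.2 ⟨hA (mem_filter.1 hx).1, hB (mem_filter.1 hx).2⟩

lemma card_add_card_le_diffRep [Fintype G] (A B : Finset G) (k : G) :
    #A + #B ≤ diffRep A B k + Fintype.card G := by
  have h1 : #{x ∈ A | x + k ∈ B} + #{x ∈ A | ¬ x + k ∈ B} = #A :=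
    card_filter_add_card_filter_not _
  have h2 : #{x ∈ A | ¬ x + k ∈ B} ≤ #Bᶜ :=
    card_le_card_of_injOn (· + k) (fun x hx => by simpa using (mem_filter.1 hx).2)
      (add_left_injective k).injOn
  have h3 := card_add_card_compl B
  unfold diffRep
  omega

lemma sum_diffRep [Fintype G] (A B : Finset G) : ∑ k, diffRep A B k = #A * #B := by
  simp only [diffRep_eq_sumRep_neg, sum_sumRep, card_image_of_injective _ neg_injective]

lemma sum_diffRep_compl [Fintype G] (A B C : Finset G) :
    ∑ k ∈ Cᶜ, diffRep A B k ≤ #{q ∈ A ×ˢ B | q.2 - q.1 ∉ C} := by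
  rw [card_eq_sum_card_fiberwise (f := fun q => q.2 - q.1) (t := Cᶜ)]
  · refine sum_le_sum fun k hk => ?_
    refine card_le_card_of_injOn (fun x => (x, x + k)) ?_ ?_
    · intro x hx
      have hx := mem_filter.1 hx
      have hk := mem_compl.1 hk
      simp [hx.1, hx.2, hk]
    · intro x _ y _ h
      exact congrArg Prod.fst h
  · intro q hq
    simpa using (mem_filter.1 hq).2

end DiffRep

lemma sum_diffRep_le [Fact p.Prime] (A B C : Finset (ZMod p)) (t : ℕ) (htA : t ≤ #A)
    (htB : t ≤ #B) (hp : #A + #B ≤ p + t) :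
    ∑ k ∈ C, diffRep A B k + t * (#A + #B) ≤ t * #C + #A * #B + t * t := by
  have hA : #(A.image (-·)) = #A := card_image_of_injective _ neg_injective
  have h := pollard (A.image (-·)) B t (by rwa [hA]) htB (by rwa [hA])
  simp only [← diffRep_eq_sumRep_neg, hA] at h
  have h1 : ∑ k ∈ C, diffRep A B k ≤ t * #C + ∑ k, (diffRep A B k - t) := by
    calc ∑ k ∈ C, diffRep A B k ≤ ∑ k ∈ C, (t + (diffRep A B k - t)) :=
          sum_le_sum fun k _ => by omega
      _ = t * #C + ∑ k ∈ C, (diffRep A B k - t) := by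
          rw [sum_add_distrib, sum_const, smul_eq_mul, mul_comm]
      _ ≤ _ := Nat.add_le_add_left (sum_le_univ_sum_of_nonneg fun _ => Nat.zero_le _) _
  have h2 : ∑ k, min t (diffRep A B k) + ∑ k, (diffRep A B k - t) = #A * #B := by
    rw [← sum_diffRep, ← sum_add_distrib]
    exact sum_congr rfl fun k _ => by omega
  omega

section Interval

/-- The first `a` terms of the enumeration `0, 1, -1, 2, -2, …`. -/
def initSeg (p a : ℕ) : Finset (ZMod p) := (range a).image (plusSeq p)

lemma initSeg_mono {a b : ℕ} (h : a ≤ b) : initSeg p a ⊆ initSeg p b :=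
  image_subset_image (range_subset_range.2 h)

lemma plusSeq_eq_intCast (p n : ℕ) :
    ∃ x : ℤ, plusSeq p n = x ∧ -(n : ℤ) ≤ 2 * x ∧ 2 * x ≤ n + 1 ∧
      (2 * x = -n ∨ 2 * x = n + 1) := by
  unfold plusSeq
  split_ifs with h
  · exact ⟨-((n / 2 : ℕ) : ℤ), by rw [Int.cast_neg, Int.cast_natCast], by omega, by omega, by omega⟩
  · exact ⟨((n + 1) / 2 : ℕ), by rw [Int.cast_natCast], by omega, by omega, by omega⟩

lemma mem_initSeg {a : ℕ} {z : ZMod p} :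
    z ∈ initSeg p a ↔ ∃ x : ℤ, (x : ZMod p) = z ∧ 1 - (a : ℤ) ≤ 2 * x ∧ 2 * x ≤ a := by
  simp only [initSeg, mem_image, mem_range]
  constructor
  · rintro ⟨n, hn, rfl⟩
    obtain ⟨x, hx, h1, h2, -⟩ := plusSeq_eq_intCast p n
    exact ⟨x, hx.symm, by omega, by omega⟩
  · rintro ⟨x, rfl, h1, h2⟩
    rcases le_or_gt x 0 with hx | hx
    · refine ⟨(-2 * x).toNat, by omega, ?_⟩
      rw [plusSeq, if_pos (by omega)]
      have : (((-2 * x).toNat / 2 : ℕ) : ℤ) = -x := by omega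
      rw [← Int.cast_natCast, this]
      simp
    · refine ⟨(2 * x - 1).toNat, by omega, ?_⟩
      rw [plusSeq, if_neg (by omega)]
      have : ((((2 * x - 1).toNat + 1) / 2 : ℕ) : ℤ) = x := by omega
      rw [← Int.cast_natCast, this]

lemma plusSeq_injOn (p : ℕ) : Set.InjOn (plusSeq p) (Set.Iio p) := by
  intro m hm n hn h
  obtain ⟨x, hx, hx1, hx2, hx3⟩ := plusSeq_eq_intCast p m
  obtain ⟨y, hy, hy1, hy2, hy3⟩ := plusSeq_eq_intCast p n
  rw [hx, hy, ZMod.intCast_eq_intCast_iff_dvd_sub] at h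
  have hm : m < p := hm
  have hn : n < p := hn
  have : y - x = 0 := Int.eq_zero_of_abs_lt_dvd h (by rw [abs_lt]; constructor <;> omega)
  omega

lemma card_initSeg {a : ℕ} (h : a ≤ p) : #(initSeg p a) = a := by
  rw [initSeg, card_image_of_injOn, card_range]
  exact (plusSeq_injOn p).mono fun x hx => by
    have := mem_range.1 (mem_coe.1 hx)
    exact Set.mem_Iio.2 (by omega)

lemma two_mul_card_le_of_triangle {S : Finset (ℤ × ℤ)} {s : ℤ} (hs : -1 ≤ s)
    (hS : ∀ q ∈ S, 0 ≤ q.1 ∧ 0 ≤ q.2 ∧ q.1 + q.2 < s) : 2 * (#S : ℤ) ≤ s * (s + 1) := by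
  have key : ∀ (n : ℕ) (S : Finset (ℤ × ℤ)),
      (∀ q ∈ S, 0 ≤ q.1 ∧ 0 ≤ q.2 ∧ q.1 + q.2 < n) → 2 * #S ≤ n * (n + 1) := by
    intro n
    induction n with
    | zero =>
      intro S hS
      have : S = ∅ := eq_empty_of_forall_notMem fun q hq => by
        have := hS q hq
        omega
      simp [this]
    | succ n ih =>
      intro S hS
      have h1 := ih {q ∈ S | q.1 + q.2 < (n : ℤ)} fun q hq => by
        have h := mem_filter.1 hq
        exact ⟨(hS q h.1).1, (hS q h.1).2.1, h.2⟩
      have h2 : #{q ∈ S | ¬ q.1 + q.2 < (n : ℤ)} ≤ #(range (n + 1)) := by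
        refine card_le_card_of_injOn (fun q => q.1.toNat) ?_ ?_
        · intro q hq
          have h := mem_filter.1 hq
          have := hS q h.1
          simp only [coe_range, Set.mem_Iio]
          omega
        · intro q hq r hr h
          have hq := mem_filter.1 hq
          have hr := mem_filter.1 hr
          have := hS q hq.1
          have := hS r hr.1
          simp only at h
          push_cast at *
          ext <;> omega
      have h3 : #{q ∈ S | q.1 + q.2 < (n : ℤ)} + #{q ∈ S | ¬ q.1 + q.2 < (n : ℤ)} = #S :=
        card_filter_add_card_filter_not _
      rw [card_range] at h2
      nlinarith
  rcases lt_or_ge s 0 with h | h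
  · have : S = ∅ := eq_empty_of_forall_notMem fun q hq => by
      have := hS q hq
      omega
    obtain rfl : s = -1 := by omega
    simp [this]
  · lift s to ℕ using h
    exact_mod_cast key s S (by exact_mod_cast hS)

lemma le_sum_diffRep_initSeg [NeZero p] {a b k t : ℕ} (ha : a ≤ p) (hb : b ≤ p)
    (hk : 2 * k + 1 ≤ a + b) (ht : t = (a + b - (2 * k + 1)) / 2) :
    a * b + t * (2 * k + 1) + t * t ≤
      ∑ z ∈ initSeg p (2 * k + 1), diffRep (initSeg p a) (initSeg p b) z + t * (a + b) := by
  set A := initSeg p a with hA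
  set B := initSeg p b with hB
  set C := initSeg p (2 * k + 1) with hC
  have htot : ∑ z ∈ C, diffRep A B z + ∑ z ∈ Cᶜ, diffRep A B z = a * b := by
    rw [sum_add_sum_compl, sum_diffRep, hA, hB, card_initSeg ha, card_initSeg hb]
  have hbad := sum_diffRep_compl A B C
  let I : Finset (ℤ × ℤ) := Icc (-(((a : ℤ) - 1) / 2)) ((a : ℤ) / 2) ×ˢ
    Icc (-(((b : ℤ) - 1) / 2)) ((b : ℤ) / 2)
  have hsub : {q ∈ A ×ˢ B | q.2 - q.1 ∉ C} ⊆
      ({q ∈ I | (k : ℤ) < q.2 - q.1} ∪ {q ∈ I | (k : ℤ) < q.1 - q.2}).image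
        (fun q => ((q.1 : ZMod p), (q.2 : ZMod p))) := by
    intro q hq
    simp only [mem_filter, mem_product, hA, hB] at hq
    obtain ⟨⟨hqa, hqb⟩, hqc⟩ := hq
    obtain ⟨x, hx, hx1, hx2⟩ := mem_initSeg.1 hqa
    obtain ⟨y, hy, hy1, hy2⟩ := mem_initSeg.1 hqb
    have hxy : ¬ (-(k : ℤ) ≤ y - x ∧ y - x ≤ k) := fun h => hqc <|
      mem_initSeg.2 ⟨y - x, by push_cast; rw [hx, hy], by push_cast; omega, by push_cast; omega⟩
    refine mem_image.2 ⟨(x, y), ?_, Prod.ext hx hy⟩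
    simp only [mem_union, mem_filter, mem_product, mem_Icc, I]
    omega
  have hle := (card_le_card hsub).trans (card_image_le.trans (card_union_le _ _))
  have h1 : 2 * (#{q ∈ I | (k : ℤ) < q.2 - q.1} : ℤ) ≤
      ((b : ℤ) / 2 + ((a : ℤ) - 1) / 2 - k) * ((b : ℤ) / 2 + ((a : ℤ) - 1) / 2 - k + 1) := by
    have hinj : Function.Injective
        (fun q : ℤ × ℤ => (q.1 + ((a : ℤ) - 1) / 2, (b : ℤ) / 2 - q.2)) := by
      intro q r h
      simp only [Prod.mk.injEq] at h
      ext <;> omega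
    rw [← card_image_of_injective _ hinj]
    refine two_mul_card_le_of_triangle (by omega) fun q hq => ?_
    obtain ⟨r, hr, rfl⟩ := mem_image.1 hq
    simp only [mem_filter, mem_product, mem_Icc, I] at hr ⊢
    omega
  have h2 : 2 * (#{q ∈ I | (k : ℤ) < q.1 - q.2} : ℤ) ≤
      ((a : ℤ) / 2 + ((b : ℤ) - 1) / 2 - k) * ((a : ℤ) / 2 + ((b : ℤ) - 1) / 2 - k + 1) := by
    have hinj : Function.Injective
        (fun q : ℤ × ℤ => ((a : ℤ) / 2 - q.1, q.2 + ((b : ℤ) - 1) / 2)) := by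
      intro q r h
      simp only [Prod.mk.injEq] at h
      ext <;> omega
    rw [← card_image_of_injective _ hinj]
    refine two_mul_card_le_of_triangle (by omega) fun q hq => ?_
    obtain ⟨r, hr, rfl⟩ := mem_image.1 hq
    simp only [mem_filter, mem_product, mem_Icc, I] at hr ⊢
    omega
  have hfin : ∑ z ∈ Cᶜ, diffRep A B z ≤ #{q ∈ I | (k : ℤ) < q.2 - q.1} + #{q ∈ I | (k : ℤ) < q.1 - q.2} :=
    hbad.trans hle
  have harith : ((b : ℤ) / 2 + ((a : ℤ) - 1) / 2 - k) * ((b : ℤ) / 2 + ((a : ℤ) - 1) / 2 - k + 1)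
      + ((a : ℤ) / 2 + ((b : ℤ) - 1) / 2 - k) * ((a : ℤ) / 2 + ((b : ℤ) - 1) / 2 - k + 1)
      = 2 * (t * (a + b - (2 * k + 1) - t)) := by
    set u := (b : ℤ) / 2 + ((a : ℤ) - 1) / 2 - k with hu
    set v := (a : ℤ) / 2 + ((b : ℤ) - 1) / 2 - k with hv
    have hsum : (a : ℤ) + b - (2 * k + 1) = u + v + 1 - 1 + 1 - 1 + 1 := by omega
    rcases (by omega : (u = v ∧ (t : ℤ) = u) ∨ (v = u + 1 ∧ (t : ℤ) = v) ∨
      (u = v + 1 ∧ (t : ℤ) = u) ∨ (u = v ∧ (t : ℤ) = u + 1)) with h | h | h | h <;>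
    · rw [hsum, h.2, h.1]
      ring
  zify at htot hfin ⊢
  nlinarith

end Interval

/-- The rearrangement inequality for indicator functions. -/
theorem sum_diffRep_le_initSeg [Fact p.Prime] (A B C : Finset (ZMod p)) (hC : Odd #C) :
    ∑ z ∈ C, diffRep A B z ≤
      ∑ z ∈ initSeg p #C, diffRep (initSeg p #A) (initSeg p #B) z := by
  have hle : ∀ S : Finset (ZMod p), #S ≤ p := fun S => by
    simpa [ZMod.card] using card_le_univ S
  have hA := hle A
  have hB := hle B
  have hCp := hle C
  obtain ⟨k, hk⟩ := hC
  rw [hk]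
  have upper := sum_diffRep_le A B C
  rw [hk] at upper
  set a := #A
  set b := #B
  rcases Nat.lt_or_ge (a + b) (2 * k + 1) with h1 | h1
  · rcases Nat.eq_zero_or_pos (a + b) with h0 | h0
    · have := upper 0 (by omega) (by omega) (by omega)
      have ha0 : a = 0 := by omega
      rw [ha0] at this
      omega
    · have hlow := le_sum_diffRep_initSeg (k := (a + b - 1) / 2) (t := 0) hA hB
        (by omega) (by omega)
      have := upper 0 (by omega) (by omega) (by omega)
      have hmono := sum_le_sum_of_subset (f := diffRep (initSeg p a) (initSeg p b))
        (initSeg_mono (p := p) (show 2 * ((a + b - 1) / 2) + 1 ≤ 2 * k + 1 by omega))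
      omega
  rcases Nat.lt_or_ge (b + (2 * k + 1)) a with h2 | h2
  · have hlow := le_sum_diffRep_initSeg (a := b + (2 * k + 1)) (k := k) (t := b) (by omega) hB
        (by omega) (by omega)
    have := upper b (by omega) (by omega) (by omega)
    have hmono : ∑ z ∈ initSeg p (2 * k + 1),
        diffRep (initSeg p (b + (2 * k + 1))) (initSeg p b) z ≤ _ :=
      sum_le_sum fun z _ => diffRep_mono (initSeg_mono h2.le) (subset_refl (initSeg p b)) z
    nlinarith
  rcases Nat.lt_or_ge (a + (2 * k + 1)) b with h3 | h3
  · have hlow := le_sum_diffRep_initSeg (b := a + (2 * k + 1)) (k := k) (t := a) hA (by omega)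
        (by omega) (by omega)
    have := upper a (by omega) (by omega) (by omega)
    have hmono : ∑ z ∈ initSeg p (2 * k + 1),
        diffRep (initSeg p a) (initSeg p (a + (2 * k + 1))) z ≤ _ :=
      sum_le_sum fun z _ => diffRep_mono (subset_refl (initSeg p a)) (initSeg_mono h3.le) z
    nlinarith
  rcases Nat.lt_or_ge (2 * p) (a + b + (2 * k + 1)) with h4 | h4
  · obtain ⟨t, ht⟩ : ∃ t, a + b = p + t := ⟨a + b - p, by omega⟩
    have hup := upper t (by omega) (by omega) (by omega)
    have hrep : ∀ z, t ≤ diffRep (initSeg p a) (initSeg p b) z := fun z => by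
      have := card_add_card_le_diffRep (initSeg p a) (initSeg p b) z
      rw [card_initSeg hA, card_initSeg hB, ZMod.card] at this
      omega
    have hsum : ∀ S : Finset (ZMod p),
        #S * t ≤ ∑ z ∈ S, diffRep (initSeg p a) (initSeg p b) z := fun S => by
      simpa using card_nsmul_le_sum S _ t fun z _ => hrep z
    rcases Nat.lt_or_ge (a + b) (2 * p) with h5 | h5
    · obtain ⟨l, hl⟩ : ∃ l, l = (2 * p - (a + b) - 1) / 2 := ⟨_, rfl⟩
      have hlow := le_sum_diffRep_initSeg (k := l) (t := t) hA hB (by omega) (by omega)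
      have hsub := initSeg_mono (p := p) (show 2 * l + 1 ≤ 2 * k + 1 by omega)
      have hsd := hsum (initSeg p (2 * k + 1) \ initSeg p (2 * l + 1))
      have hcard := card_sdiff_add_card_eq_card hsub
      have hsplit := sum_sdiff hsub (f := diffRep (initSeg p a) (initSeg p b))
      rw [card_initSeg (by omega), card_initSeg (by omega)] at hcard
      nlinarith
    · have hs := hsum (initSeg p (2 * k + 1))
      rw [card_initSeg (by omega)] at hs
      have ha : a = p := by omega
      have hb : b = p := by omega
      have htp : t = p := by omega
      rw [ha, hb, htp] at hup
      rw [htp] at hs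
      nlinarith
  · have hlow := le_sum_diffRep_initSeg (k := k) hA hB (by omega) rfl
    have := upper ((a + b - (2 * k + 1)) / 2) (by omega) (by omega) (by omega)
    omega

section PrefixMaj

lemma mul_sub_le_sum_mul_sub_sum_mul {x a a' : ℕ → ℝ} {N : ℕ}
    (h : ∀ n < N, x (n + 1) = x n ∨
      x (n + 1) ≤ x n ∧ ∑ m ∈ range (n + 1), a m ≤ ∑ m ∈ range (n + 1), a' m) :
    x N * (∑ m ∈ range (N + 1), a' m - ∑ m ∈ range (N + 1), a m) ≤
      ∑ m ∈ range (N + 1), a' m * x m - ∑ m ∈ range (N + 1), a m * x m := by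
  induction N with
  | zero =>
    simp only [zero_add, sum_range_one]
    exact le_of_eq (by ring)
  | succ N ih =>
    have ih := ih fun n hn => h n (by omega)
    have hN := h N (by omega)
    rw [sum_range_succ _ (N + 1), sum_range_succ _ (N + 1), sum_range_succ _ (N + 1),
      sum_range_succ _ (N + 1)]
    rcases hN with hN | ⟨h1, h2⟩
    · rw [hN]
      nlinarith
    · nlinarith [mul_nonneg (sub_nonneg.2 h1) (sub_nonneg.2 h2)]

/-- Comparing prefix sums of `a` and `a'` suffices to compare their sums weighted by a
nonnegative antitone `x`; prefixes ending where `x` does not drop may be skipped. -/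
lemma sum_mul_le_sum_mul_of_sum_range_le {x a a' : ℕ → ℝ} {N : ℕ} (hx : ∀ n < N, 0 ≤ x n)
    (hN : ∑ m ∈ range N, a m ≤ ∑ m ∈ range N, a' m)
    (h : ∀ n, n + 1 < N → x (n + 1) = x n ∨
      x (n + 1) ≤ x n ∧ ∑ m ∈ range (n + 1), a m ≤ ∑ m ∈ range (n + 1), a' m) :
    ∑ m ∈ range N, a m * x m ≤ ∑ m ∈ range N, a' m * x m := by
  cases N with
  | zero => simp
  | succ N =>
    have h1 := mul_sub_le_sum_mul_sub_sum_mul (N := N) fun n hn => h n (by omega)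
    nlinarith [mul_nonneg (hx N (by omega)) (sub_nonneg.2 hN)]

lemma sum_le_sum_range_card {x : ℕ → ℝ} {N : ℕ}
    (hx : ∀ n, n + 1 < N → x (n + 1) ≤ x n) (S : Finset ℕ) (hS : ∀ n ∈ S, n < N) :
    ∑ n ∈ S, x n ≤ ∑ n ∈ range #S, x n := by
  have hanti : ∀ m n, m ≤ n → n < N → x n ≤ x m := by
    intro m n hmn
    induction n, hmn using Nat.le_induction with
    | base => exact fun _ => le_rfl
    | succ n _ ih => exact fun hn => (hx n hn).trans (ih (by omega))
  induction S using Finset.induction_on_max with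
  | empty => simp
  | insert M S hM ih =>
    have hnot : M ∉ S := fun h => lt_irrefl _ (hM M h)
    have hcard : #S ≤ M := by
      simpa using card_le_card (fun n hn => mem_range.2 (hM n hn) : S ⊆ range M)
    rw [sum_insert hnot, card_insert_of_notMem hnot, sum_range_succ, add_comm]
    exact add_le_add (ih fun n hn => hS n (mem_insert_of_mem hn))
      (hanti _ _ hcard (hS M (mem_insert_self M S)))

lemma initSeg_self [NeZero p] : initSeg p p = univ := by
  rw [← card_eq_iff_eq_univ, card_initSeg le_rfl, ZMod.card]

lemma sum_initSeg {M : Type*} [AddCommMonoid M] {a : ℕ} (ha : a ≤ p) (u : ZMod p → M) :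
    ∑ z ∈ initSeg p a, u z = ∑ n ∈ range a, u (plusSeq p n) :=
  sum_image ((plusSeq_injOn p).mono fun x hx => by
    have := mem_range.1 (mem_coe.1 hx)
    exact Set.mem_Iio.2 (by omega))

lemma sum_univ_eq_sum_plusSeq {M : Type*} [AddCommMonoid M] [NeZero p] (u : ZMod p → M) :
    ∑ z, u z = ∑ n ∈ range p, u (plusSeq p n) := by
  rw [← initSeg_self, sum_initSeg le_rfl]

/-- `u'` along `0, 1, -1, 2, -2, …` has prefix sums dominating all sums of `u` over sets of the
same size. -/
def PrefixMaj (u u' : ZMod p → ℝ) : Prop :=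
  ∀ B : Finset (ZMod p), ∑ z ∈ B, u z ≤ ∑ n ∈ range #B, u' (plusSeq p n)

lemma PrefixMaj.sum_perm_le [NeZero p] {u u' : ZMod p → ℝ} (h : PrefixMaj u u')
    (σ : Equiv.Perm (ZMod p)) {a : ℕ} (ha : a ≤ p) :
    ∑ n ∈ range a, u (σ (plusSeq p n)) ≤ ∑ n ∈ range a, u' (plusSeq p n) := by
  have := h ((initSeg p a).image σ)
  rwa [sum_image σ.injective.injOn, card_image_of_injective _ σ.injective, card_initSeg ha,
    sum_initSeg ha] at this

lemma PrefixMaj.le_of_self {u : ZMod p → ℝ} (h : PrefixMaj u u) {n : ℕ} (hn : n + 1 < p) :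
    u (plusSeq p (n + 1)) ≤ u (plusSeq p n) := by
  have hinj : Set.InjOn (plusSeq p) (insert (n + 1) (range n) : Finset ℕ) :=
    (plusSeq_injOn p).mono fun x hx => by
      have := mem_coe.1 hx
      simp only [mem_insert, mem_range] at this
      exact Set.mem_Iio.2 (by omega)
  have := h ((insert (n + 1) (range n)).image (plusSeq p))
  rw [sum_image hinj, card_image_of_injOn hinj, card_insert_of_notMem (by simp),
    sum_insert (by simp), card_range, sum_range_succ] at this
  linarith

lemma prefixMaj_of_isPlusRearr [NeZero p] {f fp : ZMod p → ℝ} (h : IsPlusRearr f fp) :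
    PrefixMaj f fp := by
  obtain ⟨⟨σ, rfl⟩, hanti⟩ := h
  intro B
  set T := B.image σ.symm with hT
  set S := {n ∈ range p | plusSeq p n ∈ T} with hS
  have hinj : Set.InjOn (plusSeq p) S :=
    (plusSeq_injOn p).mono fun x hx => by
      have := mem_filter.1 (mem_coe.1 hx)
      exact Set.mem_Iio.2 (mem_range.1 this.1)
  have himg : S.image (plusSeq p) = T := by
    ext z
    have hz : z ∈ initSeg p p := initSeg_self (p := p) ▸ mem_univ z
    obtain ⟨n, hn, rfl⟩ := mem_image.1 hz
    simp only [mem_image, hS, mem_filter]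
    exact ⟨by rintro ⟨m, hm, hmn⟩; exact hmn ▸ hm.2, fun hT => ⟨n, ⟨hn, hT⟩, rfl⟩⟩
  have hcard : #S = #B := by
    rw [← card_image_of_injOn hinj, himg, hT, card_image_of_injective _ σ.symm.injective]
  calc ∑ z ∈ B, f z = ∑ z ∈ T, (f ∘ σ) z := by
        rw [hT, sum_image σ.symm.injective.injOn]
        simp
    _ = ∑ n ∈ S, (f ∘ σ) (plusSeq p n) := by rw [← himg, sum_image hinj]
    _ ≤ ∑ n ∈ range #S, (f ∘ σ) (plusSeq p n) :=
        sum_le_sum_range_card hanti S fun n hn => mem_range.1 (mem_filter.1 hn).1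
    _ = _ := by rw [hcard]

lemma exists_isPlusRearr [NeZero p] (f : ZMod p → ℝ) :
    ∃ σ : Equiv.Perm (ZMod p), IsPlusRearr f (f ∘ σ) := by
  have hbij : Function.Bijective (fun i : Fin p => plusSeq p i) := by
    rw [Fintype.bijective_iff_injective_and_card]
    refine ⟨fun i j h => Fin.ext (plusSeq_injOn p i.2 j.2 h), ?_⟩
    rw [Fintype.card_fin, ZMod.card]
  set e := Equiv.ofBijective _ hbij with he
  set τ := Tuple.sort (fun i => OrderDual.toDual (f (e i))) with hτ
  have hmono := Tuple.monotone_sort (fun i => OrderDual.toDual (f (e i)))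
  refine ⟨(e.symm.trans τ).trans e, ⟨_, rfl⟩, fun n hn => ?_⟩
  have hes : ∀ m (hm : m < p), e.symm (plusSeq p m) = ⟨m, hm⟩ := fun m hm => by
    rw [Equiv.symm_apply_eq]
    rfl
  have := hmono (show (⟨n, by omega⟩ : Fin p) ≤ ⟨n + 1, hn⟩ from Nat.le_succ n)
  simpa [hes _ hn, hes n (by omega)] using this

lemma PrefixMaj.sum_mul_le [NeZero p] {u u' v v' : ZMod p → ℝ} (hu : PrefixMaj u u')
    (hu' : PrefixMaj u' u') (hv : PrefixMaj v v') (hu0 : ∀ z, 0 ≤ u' z) (hv0 : ∀ z, 0 ≤ v z) :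
    ∑ z, u z * v z ≤ ∑ z, u' z * v' z := by
  obtain ⟨σ, -, hσ⟩ := exists_isPlusRearr v
  calc ∑ z, u z * v z = ∑ n ∈ range p, u (σ (plusSeq p n)) * v (σ (plusSeq p n)) := by
        rw [← Equiv.sum_comp σ, sum_univ_eq_sum_plusSeq]
    _ ≤ ∑ n ∈ range p, u' (plusSeq p n) * v (σ (plusSeq p n)) :=
        sum_mul_le_sum_mul_of_sum_range_le (fun n _ => hv0 _) (hu.sum_perm_le σ le_rfl)
          fun n hn => Or.inr ⟨hσ n hn, hu.sum_perm_le σ (by omega)⟩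
    _ = ∑ n ∈ range p, v (σ (plusSeq p n)) * u' (plusSeq p n) := by simp only [mul_comm]
    _ ≤ ∑ n ∈ range p, v' (plusSeq p n) * u' (plusSeq p n) :=
        sum_mul_le_sum_mul_of_sum_range_le (fun n _ => hu0 _) (hv.sum_perm_le σ le_rfl)
          fun n hn => Or.inr ⟨hu'.le_of_self hn, hv.sum_perm_le σ (by omega)⟩
    _ = ∑ z, u' z * v' z := by simp only [sum_univ_eq_sum_plusSeq, mul_comm]

end PrefixMaj

section Riesz

lemma sum_sum_sub_eq [NeZero p] (A B : Finset (ZMod p)) (h : ZMod p → ℝ) :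
    ∑ i ∈ A, ∑ b ∈ B, h (b - i) = ∑ k, (diffRep A B k : ℝ) * h k := by
  simp only [diffRep, card_filter, Nat.cast_sum, sum_mul]
  refine Eq.trans (sum_congr rfl fun i _ => ?_) sum_comm
  rw [← Equiv.sum_comp (Equiv.subRight i)]
  simp

lemma sum_sum_sub_le [Fact p.Prime] (hodd : p ≠ 2) (A B : Finset (ZMod p))
    {h hstar : ZMod p → ℝ} (hh : ∀ i, 0 ≤ h i) (hr : IsPlusRearr h hstar)
    (hsymm : ∀ z, hstar (-z) = hstar z) :
    ∑ i ∈ A, ∑ b ∈ B, h (b - i) ≤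
      ∑ i ∈ initSeg p #A, ∑ b ∈ initSeg p #B, hstar (b - i) := by
  obtain ⟨⟨σ, rfl⟩, hanti⟩ := hr
  have hpre : ∀ a ≤ p, Odd a →
      ∑ n ∈ range a, (diffRep A B (σ (plusSeq p n)) : ℝ) ≤
        ∑ n ∈ range a, (diffRep (initSeg p #A) (initSeg p #B) (plusSeq p n) : ℝ) := by
    intro a ha hao
    have hc : #((initSeg p a).image σ) = a := by
      rw [card_image_of_injective _ σ.injective, card_initSeg ha]
    have := sum_diffRep_le_initSeg A B ((initSeg p a).image σ) (by rwa [hc])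
    rw [hc, sum_image σ.injective.injOn, sum_initSeg ha, sum_initSeg ha] at this
    exact_mod_cast this
  rw [sum_sum_sub_eq, sum_sum_sub_eq, ← Equiv.sum_comp σ, sum_univ_eq_sum_plusSeq,
    sum_univ_eq_sum_plusSeq]
  refine sum_mul_le_sum_mul_of_sum_range_le (fun n _ => hh _)
    (hpre p le_rfl ((Fact.out : p.Prime).odd_of_ne_two hodd)) fun n hn => ?_
  rcases Nat.even_or_odd n with he | ho
  · exact Or.inr ⟨hanti n hn, hpre (n + 1) (by omega) he.add_one⟩
  · refine Or.inl ?_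
    have hneg : plusSeq p (n + 1) = -plusSeq p n := by
      have := Nat.odd_iff.1 ho
      rw [plusSeq, plusSeq, if_pos (by omega), if_neg (by omega)]
    have := hsymm (plusSeq p n)
    rw [← hneg] at this
    exact this

lemma sum_conv [NeZero p] (u h : ZMod p → ℝ) (B : Finset (ZMod p)) :
    ∑ b ∈ B, conv u h b = ∑ i, u i * ∑ b ∈ B, h (b - i) := by
  simp only [conv, mul_sum]
  rw [sum_comm]

lemma PrefixMaj.conv [Fact p.Prime] (hodd : p ≠ 2) {u u' h hstar : ZMod p → ℝ}
    (hu : PrefixMaj u u') (hu' : PrefixMaj u' u') (hu0 : ∀ z, 0 ≤ u' z) (hh : ∀ i, 0 ≤ h i)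
    (hr : IsPlusRearr h hstar) (hsymm : ∀ z, hstar (-z) = hstar z) :
    PrefixMaj (conv u h) (conv u' hstar) := by
  intro B
  have hB : #B ≤ p := by simpa [ZMod.card] using card_le_univ B
  rw [← sum_initSeg hB, sum_conv, sum_conv]
  refine hu.sum_mul_le hu' (fun A => ?_) hu0 fun i => sum_nonneg fun b _ => hh _
  have hA : #A ≤ p := by simpa [ZMod.card] using card_le_univ A
  exact (sum_sum_sub_le hodd A B hh hr hsymm).trans_eq (sum_initSeg hA _)

end Riesz

section Conv

variable [NeZero p]

lemma conv_comm (f g : ZMod p → ℝ) : conv f g = conv g f := by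
  ext k
  unfold conv
  rw [← Equiv.sum_comp (Equiv.subLeft k)]
  simp [mul_comm]

lemma conv_assoc (f g h : ZMod p → ℝ) : conv (conv f g) h = conv f (conv g h) := by
  ext k
  simp only [conv, sum_mul, mul_sum]
  rw [sum_comm]
  refine sum_congr rfl fun i _ => ?_
  rw [← Equiv.sum_comp (Equiv.addRight i)]
  refine sum_congr rfl fun j _ => ?_
  simp only [Equiv.coe_addRight, add_sub_cancel_right, mul_assoc]
  rw [show k - (j + i) = k - i - j by ring]

lemma conv_left_comm (f g h : ZMod p → ℝ) : conv f (conv g h) = conv g (conv f h) := by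
  rw [← conv_assoc, conv_comm f g, conv_assoc]

lemma conv_convList_nil (f : ZMod p → ℝ) : conv f (convList []) = f := by
  ext k
  simp [conv, convList, sub_eq_zero]

lemma conv_convList_cons (f g : ZMod p → ℝ) (l : List (ZMod p → ℝ)) :
    conv f (convList (g :: l)) = conv (conv f g) (convList l) :=
  (conv_assoc f g _).symm

lemma conv_nonneg {f g : ZMod p → ℝ} (hf : ∀ i, 0 ≤ f i) (hg : ∀ i, 0 ≤ g i) (i : ZMod p) :
    0 ≤ conv f g i :=
  sum_nonneg fun _ _ => mul_nonneg (hf _) (hg _)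

end Conv

lemma IsPlusRearr.nonneg {f fp : ZMod p → ℝ} (h : IsPlusRearr f fp) (hf : ∀ i, 0 ≤ f i)
    (i : ZMod p) : 0 ≤ fp i := by
  obtain ⟨⟨σ, rfl⟩, -⟩ := h
  exact hf _

lemma IsPlusRearr.self {f fp : ZMod p → ℝ} (h : IsPlusRearr f fp) : IsPlusRearr fp fp :=
  ⟨⟨Equiv.refl _, rfl⟩, h.2⟩

lemma IsMinusRearr.comp_neg {f fm : ZMod p → ℝ} (h : IsMinusRearr f fm) :
    IsPlusRearr (fun z => f (-z)) (fun z => fm (-z)) := by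
  obtain ⟨⟨σ, rfl⟩, hanti⟩ := h
  refine ⟨⟨((Equiv.neg _).trans σ).trans (Equiv.neg _), ?_⟩, hanti⟩
  ext z
  simp

lemma PrefixMaj.conv_convList_ofFn [Fact p.Prime] (hodd : p ≠ 2) {n : ℕ}
    {u u' : ZMod p → ℝ} (h hstar : Fin n → ZMod p → ℝ) (hu : PrefixMaj u u')
    (hu' : PrefixMaj u' u') (hu0 : ∀ z, 0 ≤ u' z) (hh : ∀ j i, 0 ≤ h j i)
    (hreg : ∀ j, IsPlusRearr (h j) (hstar j) ∧ ∀ z, hstar j (-z) = hstar j z) :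
    PrefixMaj (Paper.conv u (convList (List.ofFn h)))
      (Paper.conv u' (convList (List.ofFn hstar))) ∧
    PrefixMaj (Paper.conv u' (convList (List.ofFn hstar)))
      (Paper.conv u' (convList (List.ofFn hstar))) ∧
    ∀ z, 0 ≤ Paper.conv u' (convList (List.ofFn hstar)) z := by
  induction n generalizing u u' with
  | zero =>
    simp only [List.ofFn_zero, conv_convList_nil]
    exact ⟨hu, hu', hu0⟩
  | succ n ih =>
    simp only [List.ofFn_succ, conv_convList_cons]
    have hs0 := (hreg 0).1.nonneg (hh 0)
    exact ih _ _ (hu.conv hodd hu' hu0 (hh 0) (hreg 0).1 (hreg 0).2)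
      (hu'.conv hodd hu' hu0 hs0 (hreg 0).1.self (hreg 0).2)
      (conv_nonneg hu0 hs0) (fun j => hh j.succ) (fun j => hreg j.succ)

lemma convList_cons_cons_zero [NeZero p] (f g : ZMod p → ℝ) (l : List (ZMod p → ℝ)) :
    convList (f :: g :: l) 0 = ∑ z, conv f (convList l) z * g (-z) := by
  change conv f (conv g (convList l)) 0 = _
  rw [conv_left_comm, conv_comm]
  simp [conv]

/-- Lev–Hardy–Littlewood–Pólya rearrangement inequality: for nonnegative `f, g` and
`△`-regular `h₁, ..., hₙ` on `ZMod p` (`p` an odd prime),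
`(f ⋆ g ⋆ h₁ ⋆ ⋯ ⋆ hₙ)(0) ≤ (f⁺ ⋆ g⁻ ⋆ h₁* ⋆ ⋯ ⋆ hₙ*)(0)`. -/
theorem lev_HLP_rearrangement (hp : p.Prime) (hodd : p ≠ 2) [NeZero p] {n : ℕ}
    (f g : ZMod p → ℝ) (hf : ∀ i, 0 ≤ f i) (hg : ∀ i, 0 ≤ g i)
    (fp fm : ZMod p → ℝ) (hfp : IsPlusRearr f fp) (hgm : IsMinusRearr g fm)
    (h hstar : Fin n → ZMod p → ℝ) (hh : ∀ j i, 0 ≤ h j i)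
    (hreg : ∀ j, IsPlusRearr (h j) (hstar j) ∧ ∀ z, hstar j (-z) = hstar j z) :
    convList (f :: g :: List.ofFn h) 0 ≤ convList (fp :: fm :: List.ofFn hstar) 0 := by
  have : Fact p.Prime := ⟨hp⟩
  obtain ⟨h1, h2, h3⟩ := (prefixMaj_of_isPlusRearr hfp).conv_convList_ofFn hodd h hstar
    (prefixMaj_of_isPlusRearr hfp.self) (hfp.nonneg hf) hh hreg
  rw [convList_cons_cons_zero, convList_cons_cons_zero]
  exact h1.sum_mul_le h2 (prefixMaj_of_isPlusRearr hgm.comp_neg) h3 fun z => hg (-z)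

end Paper
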